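/- Let 0<q<1, a,b ∈ ℝ, and m ∈ ℕ with m ≥ 1. Then for every real x, the m-th derivative of the function x \mapsto R(a,b,q,x) at x equals \sum_{r=0}^{m} q^{r(r-1)/2} · \binom{m}{r}_q · a^{m-r} · b^r · R(a,b,q,q^r x), where \binom{m}{r}_q is the Gaussian binomial coefficient. -/

import Mathlib

open Finset

/-- The Ramanujan function `R(a,b,q,x) = 1 + ∑_{n≥1} (xⁿ/n!) ∏_{j=0}^{n-1} (a + b qʲ)`,
written as a single `tsum` (the `n = 0` term equals `1`). -/
noncomputable def ramanujanR (a b q x : ℝ) : ℝ :=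
  ∑' n : ℕ, x ^ n / (Nat.factorial n : ℝ) * ∏ j ∈ Finset.range n, (a + b * q ^ j)

/-- The Gaussian binomial coefficient `(n r)_q`:
`((1-qⁿ)(1-q^{n-1})⋯(1-q^{n-r+1})) / ((1-q)(1-q²)⋯(1-qʳ))` if `r ≤ n`, and `0` if `r > n`. -/
noncomputable def gaussBinom (q : ℝ) (n r : ℕ) : ℝ :=
  if r ≤ n then
    (∏ i ∈ Finset.range r, (1 - q ^ (n - i))) / ∏ i ∈ Finset.range r, (1 - q ^ (i + 1))
  else 0

theorem gaussBinom_eq_div (q : ℝ) (n r : ℕ) :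
    gaussBinom q n r =
      (∏ i ∈ Finset.range r, (1 - q ^ (n - i))) / ∏ i ∈ Finset.range r, (1 - q ^ (i + 1)) := by
  unfold gaussBinom
  split_ifs with h
  · rfl
  · rw [Finset.prod_eq_zero (Finset.mem_range.2 (not_le.1 h)) (by simp), zero_div]

theorem gaussBinom_eq_zero {q : ℝ} {n r : ℕ} (h : n < r) : gaussBinom q n r = 0 :=
  if_neg (not_le.2 h)

theorem gaussBinom_zero_right (q : ℝ) (n : ℕ) : gaussBinom q n 0 = 1 := by
  simp [gaussBinom]

/-- The `q`-Pascal identity. -/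
theorem gaussBinom_succ_succ {q : ℝ} (hq0 : 0 ≤ q) (hq1 : q < 1) {m r : ℕ} (h : r ≤ m) :
    gaussBinom q (m + 1) (r + 1) = q ^ (r + 1) * gaussBinom q m (r + 1) + gaussBinom q m r := by
  have hne (i : ℕ) : 1 - q ^ (i + 1) ≠ 0 :=
    (sub_pos.2 (pow_lt_one₀ hq0 hq1 i.succ_ne_zero)).ne'
  have hD : ∏ i ∈ Finset.range r, (1 - q ^ (i + 1)) ≠ 0 :=
    Finset.prod_ne_zero_iff.2 fun i _ => hne i
  have hr := hne r
  have hpow : q ^ (m + 1) = q ^ (r + 1) * q ^ (m - r) := by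
    rw [← pow_add]; congr 1; omega
  simp only [gaussBinom_eq_div]
  rw [Finset.prod_range_succ' (fun i => 1 - q ^ (m + 1 - i)),
    Finset.prod_range_succ (fun i => 1 - q ^ (m - i)),
    Finset.prod_range_succ (fun i => 1 - q ^ (i + 1))]
  simp only [Nat.add_sub_add_right, Nat.sub_zero, hpow]
  field_simp
  ring

theorem abs_prod_add_mul_pow_le {q : ℝ} (hq0 : 0 ≤ q) (hq1 : q ≤ 1) (a b : ℝ) (n : ℕ) :
    |∏ j ∈ Finset.range n, (a + b * q ^ j)| ≤ (|a| + |b|) ^ n := by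
  rw [Finset.abs_prod]
  refine (Finset.prod_le_prod (fun _ _ => abs_nonneg _)
    (g := fun _ => |a| + |b|) fun j _ => ?_).trans (by simp)
  refine (abs_add_le _ _).trans ?_
  rw [abs_mul, abs_of_nonneg (pow_nonneg hq0 j)]
  gcongr
  exact mul_le_of_le_one_right (abs_nonneg b) (pow_le_one₀ hq0 hq1)

theorem summable_ramanujanR {q : ℝ} (hq0 : 0 ≤ q) (hq1 : q ≤ 1) (a b x : ℝ) :
    Summable fun n : ℕ =>
      x ^ n / (Nat.factorial n : ℝ) * ∏ j ∈ Finset.range n, (a + b * q ^ j) := by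
  refine Summable.of_norm_bounded (Real.summable_pow_div_factorial (|x| * (|a| + |b|)))
    fun n => ?_
  rw [Real.norm_eq_abs, abs_mul, abs_div, abs_pow, Nat.abs_cast, mul_pow, mul_div_right_comm]
  gcongr
  exact abs_prod_add_mul_pow_le hq0 hq1 a b n

theorem hasDerivAt_ramanujanR {q : ℝ} (hq0 : 0 ≤ q) (hq1 : q ≤ 1) (a b x : ℝ) :
    HasDerivAt (ramanujanR a b q) (a * ramanujanR a b q x + b * ramanujanR a b q (q * x)) x := by
  set P : ℕ → ℝ := fun n => ∏ j ∈ Finset.range n, (a + b * q ^ j) with hP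
  set ρ := |x| + 1
  set K := |a| + |b|
  have hsucc (n : ℕ) (y : ℝ) :
      ((n + 1 : ℕ) : ℝ) * y ^ (n + 1 - 1) / ((n + 1).factorial : ℝ) = y ^ n / (n.factorial : ℝ) := by
    have := Nat.factorial_ne_zero n
    rw [Nat.factorial_succ, Nat.cast_mul, Nat.add_sub_cancel]
    field_simp
  have hu : Summable fun n : ℕ => (n : ℝ) * ρ ^ (n - 1) / (n.factorial : ℝ) * K ^ n := by
    refine (summable_nat_add_iff 1).1 (((Real.summable_pow_div_factorial (ρ * K)).mul_right K).congr
      fun n => ?_)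
    rw [hsucc, mul_pow, pow_succ]
    ring
  have hmem : x ∈ Metric.ball (0 : ℝ) ρ := by simp [ρ]
  have hderiv := hasDerivAt_tsum_of_isPreconnected hu Metric.isOpen_ball
    (convex_ball (0 : ℝ) ρ).isPreconnected
    (g := fun n y => y ^ n / (n.factorial : ℝ) * P n)
    (g' := fun n y => (n : ℝ) * y ^ (n - 1) / (n.factorial : ℝ) * P n)
    (fun n y _ => ((hasDerivAt_pow n y).div_const _).mul_const _)
    (fun n y hy => by
      have hy' : |y| ≤ ρ := by simpa using (mem_ball_zero_iff.1 hy).le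
      rw [Real.norm_eq_abs, abs_mul, abs_div, abs_mul, abs_pow, Nat.abs_cast, Nat.abs_cast]
      gcongr
      exact abs_prod_add_mul_pow_le hq0 hq1 a b n)
    hmem (summable_ramanujanR hq0 hq1 a b x) hmem
  refine HasDerivAt.congr_deriv hderiv ?_
  have hterm (n : ℕ) : ((n + 1 : ℕ) : ℝ) * x ^ (n + 1 - 1) / ((n + 1).factorial : ℝ) * P (n + 1) =
      a * (x ^ n / (n.factorial : ℝ) * P n) + b * ((q * x) ^ n / (n.factorial : ℝ) * P n) := by
    simp only [hsucc, hP, Finset.prod_range_succ, mul_pow]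
    ring
  have h₁ := (summable_ramanujanR hq0 hq1 a b x).mul_left a
  have h₂ := (summable_ramanujanR hq0 hq1 a b (q * x)).mul_left b
  have hsum : Summable fun n : ℕ => (n : ℝ) * x ^ (n - 1) / (n.factorial : ℝ) * P n :=
    (summable_nat_add_iff 1).1 ((h₁.add h₂).congr fun n => (hterm n).symm)
  rw [hsum.tsum_eq_zero_add, tsum_congr hterm, h₁.tsum_add h₂, tsum_mul_left, tsum_mul_left]
  simp [ramanujanR, hP]

theorem iteratedDeriv_ramanujanR {q : ℝ} (hq0 : 0 ≤ q) (hq1 : q < 1) (a b : ℝ) (m : ℕ) :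
    iteratedDeriv m (ramanujanR a b q) = fun x =>
      ∑ r ∈ Finset.range (m + 1),
        q ^ (r * (r - 1) / 2) * gaussBinom q m r * a ^ (m - r) * b ^ r *
          ramanujanR a b q (q ^ r * x) := by
  induction m with
  | zero => simp [gaussBinom_zero_right]
  | succ m ih =>
    ext x
    rw [iteratedDeriv_succ, ih]
    have hR (r : ℕ) : HasDerivAt (fun y => ramanujanR a b q (q ^ r * y))
        ((a * ramanujanR a b q (q ^ r * x) + b * ramanujanR a b q (q ^ (r + 1) * x)) * q ^ r) x := by
      have h := (hasDerivAt_ramanujanR hq0 hq1.le a b (q ^ r * x)).comp x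
        ((hasDerivAt_id x).const_mul (q ^ r))
      rw [mul_one, ← mul_assoc q, ← pow_succ'] at h
      exact h
    rw [(HasDerivAt.fun_sum fun r _ => (hR r).const_mul _).deriv]
    set A : ℕ → ℝ := fun r => q ^ (r * (r - 1) / 2) * gaussBinom q m r * a ^ (m - r) * b ^ r *
      (a * ramanujanR a b q (q ^ r * x) * q ^ r) with hA
    set B : ℕ → ℝ := fun r => q ^ (r * (r - 1) / 2) * gaussBinom q m r * a ^ (m - r) * b ^ r *
      (b * ramanujanR a b q (q ^ (r + 1) * x) * q ^ r) with hB
    have hAlast : A (m + 1) = 0 := by simp [hA, gaussBinom_eq_zero m.lt_succ_self]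
    have hstep : ∀ r ∈ Finset.range (m + 1),
        q ^ ((r + 1) * (r + 1 - 1) / 2) * gaussBinom q (m + 1) (r + 1) *
          a ^ (m + 1 - (r + 1)) * b ^ (r + 1) * ramanujanR a b q (q ^ (r + 1) * x) =
        A (r + 1) + B r := by
      intro r hr
      have hrm : r ≤ m := Nat.lt_succ_iff.1 (Finset.mem_range.1 hr)
      have htri : q ^ ((r + 1) * (r + 1 - 1) / 2) = q ^ (r * (r - 1) / 2) * q ^ r := by
        rw [← pow_add, Nat.triangle_succ]
      have ha : gaussBinom q m (r + 1) * a ^ (m - r) =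
          gaussBinom q m (r + 1) * (a ^ (m - (r + 1)) * a) := by
        rcases hrm.lt_or_eq with h | rfl
        · rw [← pow_succ]; congr 2; omega
        · simp [gaussBinom_eq_zero r.lt_succ_self]
      simp only [hA, hB]
      rw [gaussBinom_succ_succ hq0 hq1 hrm, htri, Nat.add_sub_add_right]
      linear_combination q ^ (r * (r - 1) / 2) * q ^ r * q ^ (r + 1) * b ^ (r + 1) *
        ramanujanR a b q (q ^ (r + 1) * x) * ha
    calc _ = ∑ r ∈ Finset.range (m + 1), (A r + B r) :=
          Finset.sum_congr rfl fun r _ => by simp only [hA, hB]; ring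
      _ = ∑ r ∈ Finset.range (m + 1), (A (r + 1) + B r) + A 0 := by
          rw [Finset.sum_add_distrib, Finset.sum_add_distrib, add_right_comm,
            ← Finset.sum_range_succ', Finset.sum_range_succ A (m + 1), hAlast, add_zero]
      _ = _ := by
          rw [Finset.sum_range_succ' _ (m + 1), Finset.sum_congr rfl hstep]
          simp [hA, gaussBinom_zero_right, pow_succ, mul_assoc]

/-- The `m`-th derivative of `R(a,b,q,·)` is
`∑_{r=0}^{m} q^{r(r-1)/2} (m r)_q a^{m-r} bʳ R(a,b,q,qʳ x)`. -/
theorem stmt_4 (q a b : ℝ) (hq0 : 0 < q) (hq1 : q < 1) (m : ℕ) (hm : 1 ≤ m) :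
    ∀ x : ℝ, iteratedDeriv m (fun t => ramanujanR a b q t) x =
      ∑ r ∈ Finset.range (m + 1),
        q ^ (r * (r - 1) / 2) * gaussBinom q m r * a ^ (m - r) * b ^ r *
          ramanujanR a b q (q ^ r * x) := by
  exact congrFun (iteratedDeriv_ramanujanR hq0.le hq1 a b m)
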